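/- Let A be a finite alphabet with d ≥ 2 letters, let B be a binary alphabet, and let X ⊆ A* be a finite synchronizing set all of whose words have length at most n (n ≥ 1). Let c be a positive integer such that every finite synchronizing set Y ⊆ B* whose words all have length at most ⌈log₂(d+1)⌉·n has a synchronizing pair (u,v) with |u·v| ≤ c. Then X has a synchronizing pair (u,v) with |u·v| ≤ ⌈c / ⌈log₂(d+1)⌉⌉. -/

import Mathlib

/-- The Kleene star of a set of words: the submonoid of the free monoid generated by `X`. -/
def Kstar {A : Type*} (X : Set (List A)) : Set (List A) :=
  {w | ∃ l : List (List A), (∀ x ∈ l, x ∈ X) ∧ l.flatten = w}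

/-- `X` is complete: every word has an `X`-completion. -/
def IsCompleteSet {A : Type*} (X : Set (List A)) : Prop :=
  ∀ w : List A, ∃ r s : List A, r ++ w ++ s ∈ Kstar X

/-- `(u, v)` is a synchronizing pair of `X`. -/
def IsSyncPair {A : Type*} (X : Set (List A)) (u v : List A) : Prop :=
  u ∈ Kstar X ∧ v ∈ Kstar X ∧
    ∀ r s : List A, r ++ (u ++ v) ++ s ∈ Kstar X →
      r ++ u ∈ Kstar X ∧ v ++ s ∈ Kstar X

/-- `X` is synchronizing: it has a synchronizing pair. -/
def IsSynchronizing {A : Type*} (X : Set (List A)) : Prop :=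
  ∃ u v : List A, IsSyncPair X u v

/-- `c` is a constant of `X`. -/
def IsConstant {A : Type*} (X : Set (List A)) (c : List A) : Prop :=
  c ∈ Kstar X ∧ ∀ u₁ u₂ u₃ u₄ : List A,
    u₁ ++ c ++ u₂ ∈ Kstar X → u₃ ++ c ++ u₄ ∈ Kstar X →
      u₁ ++ c ++ u₄ ∈ Kstar X ∧ u₃ ++ c ++ u₂ ∈ Kstar X

/-- `X` is a code: every word of `X*` has a unique factorization into words of `X`. -/
def IsCode {A : Type*} (X : Set (List A)) : Prop :=
  ∀ l₁ l₂ : List (List A), (∀ x ∈ l₁, x ∈ X) → (∀ x ∈ l₂, x ∈ X) →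
    l₁.flatten = l₂.flatten → l₁ = l₂

/-- `X` is a prefix code: no word of `X` is a proper prefix of another, and `X ≠ {ε}`. -/
def IsPrefixCode {A : Type*} (X : Set (List A)) : Prop :=
  (∀ x ∈ X, ∀ y ∈ X, x <+: y → x = y) ∧ X ≠ {([] : List A)}

/-- The monoid morphism `A* → B*` generated by the map `f` on letters. -/
def mlift {A B : Type*} (f : A → List B) : List A → List B :=
  fun w => (w.map f).flatten

section UniformMorphism

variable {A B : Type*}

theorem append_mem_Kstar {X : Set (List A)} {u v : List A} (hu : u ∈ Kstar X)
    (hv : v ∈ Kstar X) : u ++ v ∈ Kstar X := by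
  obtain ⟨l, hl, rfl⟩ := hu
  obtain ⟨m, hm, rfl⟩ := hv
  refine ⟨l ++ m, fun x hx => ?_, by simp⟩
  rcases List.mem_append.1 hx with h | h
  exacts [hl x h, hm x h]

theorem nil_mem_Kstar (X : Set (List A)) : [] ∈ Kstar X :=
  ⟨[], by simp, rfl⟩

theorem subset_Kstar (X : Set (List A)) : X ⊆ Kstar X :=
  fun x hx => ⟨[x], by simpa using hx, by simp⟩

theorem mlift_append (φ : A → List B) (u v : List A) :
    mlift φ (u ++ v) = mlift φ u ++ mlift φ v := by
  simp [mlift]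

theorem mlift_cons (φ : A → List B) (a : A) (u : List A) :
    mlift φ (a :: u) = φ a ++ mlift φ u := by
  simp [mlift]

theorem Kstar_image_mlift (φ : A → List B) (X : Set (List A)) :
    Kstar (mlift φ '' X) = mlift φ '' Kstar X := by
  ext w
  constructor
  · rintro ⟨l, hl, rfl⟩
    induction l with
    | nil => exact ⟨[], nil_mem_Kstar X, rfl⟩
    | cons y l ih =>
      obtain ⟨x, hx, rfl⟩ := hl y (by simp)
      obtain ⟨t, ht, h⟩ := ih fun z hz => hl z (by simp [hz])
      exact ⟨x ++ t, append_mem_Kstar (subset_Kstar X hx) ht, by simp [mlift_append, h]⟩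
  · rintro ⟨_, ⟨l, hl, rfl⟩, rfl⟩
    induction l with
    | nil => exact nil_mem_Kstar _
    | cons x l ih =>
      rw [List.flatten_cons, mlift_append]
      exact append_mem_Kstar (subset_Kstar _ ⟨x, hl x (by simp), rfl⟩)
        (ih fun z hz => hl z (by simp [hz]))

variable {φ : A → List B} {k : ℕ}

theorem length_mlift (hφ : ∀ a, (φ a).length = k) (t : List A) :
    (mlift φ t).length = k * t.length := by
  induction t with
  | nil => simp [mlift]
  | cons a t ih => rw [mlift_cons, List.length_append, hφ, ih, List.length_cons]; ring

theorem getElem?_mlift (hφ : ∀ a, (φ a).length = k) (t : List A) (i : ℕ) {j : ℕ} (hj : j < k) :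
    (mlift φ t)[k * i + j]? = t[i]?.bind fun x => (φ x)[j]? := by
  induction t generalizing i with
  | nil => simp [mlift]
  | cons a t ih =>
    rw [mlift_cons]
    cases i with
    | zero => rw [List.getElem?_append_left (by simp [hφ, hj])]; simp
    | succ i =>
      have h : k * (i + 1) + j = k * i + j + k := by ring
      rw [List.getElem?_append_right (by rw [hφ]; omega), hφ, h, Nat.add_sub_cancel, ih]
      simp

theorem mlift_injective (hφ : ∀ a, (φ a).length = k) (hk : 0 < k) (hinj : Function.Injective φ) :
    Function.Injective (mlift φ) := by
  intro s t h
  have hlen : s.length = t.length := by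
    have := congrArg List.length h
    rw [length_mlift hφ, length_mlift hφ] at this
    exact Nat.eq_of_mul_eq_mul_left hk this
  induction s generalizing t with
  | nil => exact (List.length_eq_zero_iff.1 hlen.symm).symm
  | cons a s ih =>
    cases t with
    | nil => simp at hlen
    | cons b t =>
      rw [mlift_cons, mlift_cons] at h
      obtain ⟨h₁, h₂⟩ := List.append_inj h (by rw [hφ, hφ])
      rw [hinj h₁, ih h₂ (by simpa using hlen)]

theorem exists_append_of_mlift_eq_append (hφ : ∀ a, (φ a).length = k) (hk : 0 < k)
    {t : List A} {r y : List B} (h : mlift φ t = r ++ y) (hr : k ∣ r.length) :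
    ∃ t₁ t₂, t = t₁ ++ t₂ ∧ r = mlift φ t₁ ∧ y = mlift φ t₂ := by
  obtain ⟨m, hm⟩ := hr
  have hlen := congrArg List.length h
  rw [length_mlift hφ, List.length_append, hm] at hlen
  have hmt : m ≤ t.length := Nat.le_of_mul_le_mul_left (by omega) hk
  have h' : mlift φ (t.take m) ++ mlift φ (t.drop m) = r ++ y := by
    rw [← mlift_append, List.take_append_drop, h]
  obtain ⟨h₁, h₂⟩ := List.append_inj h' (by simp [length_mlift hφ, hm, hmt])
  exact ⟨_, _, (List.take_append_drop m t).symm, h₁.symm, h₂.symm⟩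

/-- A uniform injective morphism maps a synchronizing pair, extended by a word of `X*` whose image
can only occur at aligned positions, to a synchronizing pair. -/
theorem IsSyncPair.mlift_image (hφ : ∀ a, (φ a).length = k) (hk : 0 < k)
    (hinj : Function.Injective φ) {X : Set (List A)} {u v z : List A} (huv : IsSyncPair X u v)
    (hz : z ∈ Kstar X)
    (haligned : ∀ t ∈ Kstar X, ∀ r s, mlift φ t = r ++ mlift φ z ++ s → k ∣ r.length) :
    IsSyncPair (mlift φ '' X) (mlift φ u) (mlift φ (v ++ z)) := by
  obtain ⟨hu, hv, hsync⟩ := huv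
  rw [IsSyncPair, Kstar_image_mlift]
  refine ⟨⟨u, hu, rfl⟩, ⟨_, append_mem_Kstar hv hz, rfl⟩, ?_⟩
  rintro r s ⟨t, ht, h⟩
  have hr : k ∣ r.length := by
    have := haligned t ht (r ++ mlift φ (u ++ v)) s (by simp [h, mlift_append])
    rw [List.length_append, length_mlift hφ] at this
    exact (Nat.dvd_add_left (dvd_mul_right _ _)).1 this
  rw [← mlift_append, List.append_assoc] at h
  obtain ⟨t₁, t', rfl, rfl, h'⟩ := exists_append_of_mlift_eq_append hφ hk h hr
  obtain ⟨t₂, t₃, rfl, h₂, rfl⟩ := exists_append_of_mlift_eq_append hφ hk h'.symm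
    (by rw [length_mlift hφ]; exact dvd_mul_right _ _)
  obtain rfl := mlift_injective hφ hk hinj h₂
  obtain ⟨h₁, h₃⟩ := hsync t₁ (z ++ t₃) (by simpa using ht)
  exact ⟨⟨_, h₁, mlift_append _ _ _⟩, ⟨_, h₃, by simp [mlift_append]⟩⟩

/-- A synchronizing pair of the image of `X` under a uniform injective morphism is the image of
a synchronizing pair of `X`. -/
theorem IsSyncPair.exists_of_mlift_image (hφ : ∀ a, (φ a).length = k) (hk : 0 < k)
    (hinj : Function.Injective φ) {X : Set (List A)} {u' v' : List B}
    (h : IsSyncPair (mlift φ '' X) u' v') :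
    ∃ u v, IsSyncPair X u v ∧ u' = mlift φ u ∧ v' = mlift φ v := by
  rw [IsSyncPair, Kstar_image_mlift] at h
  obtain ⟨⟨u, hu, rfl⟩, ⟨v, hv, rfl⟩, hsync⟩ := h
  have hmem : ∀ w, mlift φ w ∈ mlift φ '' Kstar X → w ∈ Kstar X := fun w hw =>
    (mlift_injective hφ hk hinj).mem_set_image.1 hw
  refine ⟨u, v, ⟨hu, hv, fun r s hrs => ?_⟩, rfl, rfl⟩
  obtain ⟨h₁, h₂⟩ := hsync (mlift φ r) (mlift φ s) ⟨_, hrs, by simp [mlift_append]⟩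
  rw [← mlift_append] at h₁ h₂
  exact ⟨hmem _ h₁, hmem _ h₂⟩

end UniformMorphism

theorem exists_injective_apply_eq_apply_eq {A S : Type*} [Fintype A] [Fintype S]
    (hcard : Fintype.card A ≤ Fintype.card S) {a b : A} (hab : a ≠ b) {x y : S} (hxy : x ≠ y) :
    ∃ g : A → S, Function.Injective g ∧ g a = x ∧ g b = y := by
  classical
  obtain ⟨g⟩ := Function.Embedding.nonempty_of_card_le hcard
  have hbx : Equiv.swap (g a) x (g b) ≠ x := fun h =>
    hab (g.injective ((Equiv.swap (g a) x).injective (by rw [h, Equiv.swap_apply_left])))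
  refine ⟨fun c => Equiv.swap (Equiv.swap (g a) x (g b)) y (Equiv.swap (g a) x (g c)),
    (Equiv.injective _).comp ((Equiv.injective _).comp g.injective), ?_, by simp⟩
  simp [Equiv.swap_apply_of_ne_of_ne hbx.symm hxy]

/-- Block codes of length `k` with a spare word `0^k` in which `a` is encoded by `10^(k-1)` and `b`
by `0^(k-1)1`. -/
theorem exists_block_code {A B : Type*} [Fintype A] [Fintype B] (hB : Fintype.card B = 2) {k : ℕ}
    (hk : 2 ≤ k) (hA : Fintype.card A + 1 ≤ 2 ^ k) {a b : A} (hab : a ≠ b) {o i : B} (hoi : o ≠ i) :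
    ∃ φ : A → List B, (∀ c, (φ c).length = k) ∧ Function.Injective φ ∧
      (∀ c, ∃ j < k, (φ c)[j]? ≠ some o) ∧
      (∀ j < k, (φ a)[j]? = some (if j = 0 then i else o)) ∧
      (∀ j < k, (φ b)[j]? = some (if j + 1 = k then i else o)) := by
  classical
  let x : Fin k → B := fun j => if j.1 = 0 then i else o
  let y : Fin k → B := fun j => if j.1 + 1 = k then i else o
  have hx : x ≠ fun _ => o := fun h => hoi (by simpa [x] using (congrFun h ⟨0, by omega⟩).symm)
  have hy : y ≠ fun _ => o := fun h => hoi (by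
    have := congrFun h ⟨k - 1, by omega⟩
    simp only [y, show k - 1 + 1 = k by omega, if_true] at this
    exact this.symm)
  have hxy : x ≠ y := fun h => hoi (by
    have := congrFun h ⟨0, by omega⟩
    simp only [x, y, if_true, show ¬ (0 + 1 = k) by omega, if_false] at this
    exact this.symm)
  have hcard : Fintype.card A ≤ Fintype.card {g : Fin k → B // g ≠ fun _ => o} := by
    rw [Fintype.card_subtype_compl, Fintype.card_subtype_eq, Fintype.card_fun, hB, Fintype.card_fin]
    omega
  obtain ⟨g, hg, ha, hb⟩ := exists_injective_apply_eq_apply_eq hcard hab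
    (x := ⟨x, hx⟩) (y := ⟨y, hy⟩) (by simpa [Subtype.ext_iff] using hxy)
  refine ⟨fun c => List.ofFn (g c).1, by simp, fun c c' h => hg (Subtype.ext (List.ofFn_injective h)),
    fun c => ?_, fun j hj => ?_, fun j hj => ?_⟩
  · obtain ⟨j, hj⟩ := Function.ne_iff.1 (g c).2
    exact ⟨j, j.2, by simpa using hj⟩
  · simp [ha, hj, x]
  · simp [hb, hj, y]

/-- An occurrence of `10^(k-1)0^(k-1)1` among blocks of length `k` other than `0^k` is aligned. -/
theorem dvd_length_of_mlift_eq {A B : Type*} {φ : A → List B} {k : ℕ} {a b : A} {o i : B}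
    (hφ : ∀ c, (φ c).length = k) (hk : 0 < k) (hne : ∀ c, ∃ j < k, (φ c)[j]? ≠ some o)
    (ha : ∀ j < k, (φ a)[j]? = some (if j = 0 then i else o))
    (hb : ∀ j < k, (φ b)[j]? = some (if j + 1 = k then i else o))
    {t : List A} {r s : List B} (h : mlift φ t = r ++ (φ a ++ φ b) ++ s) : k ∣ r.length := by
  by_contra hdvd
  have hmod : r.length % k ≠ 0 := fun h₀ => hdvd (Nat.dvd_of_mod_eq_zero h₀)
  have hlt := Nat.mod_lt r.length hk
  have hdiv := Nat.div_add_mod r.length k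
  set q := r.length / k
  set m := r.length % k
  have hzero : ∀ j < k, (mlift φ t)[k * (q + 1) + j]? = some o := by
    intro j hj
    have hq : k * (q + 1) + j - r.length = k - m + j := by rw [mul_add]; omega
    rw [h, List.append_assoc, List.getElem?_append_right (by rw [mul_add]; omega), hq,
      List.getElem?_append_left (by simp only [List.length_append, hφ]; omega)]
    rcases lt_or_ge (k - m + j) k with hlt' | hge
    · rw [List.getElem?_append_left (by rw [hφ]; exact hlt'), ha _ hlt', if_neg (by omega)]
    · rw [List.getElem?_append_right (by rw [hφ]; exact hge), hφ, hb _ (by omega),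
        if_neg (by omega)]
  have hget := fun j hj => (getElem?_mlift hφ t (q + 1) hj).symm.trans (hzero j hj)
  cases hc : t[q + 1]? with
  | none => simpa [hc] using hget 0 hk
  | some c =>
    obtain ⟨j, hj, hjo⟩ := hne c
    exact hjo (by simpa [hc] using hget j hj)

/-- Either some word of `X*` has two distinct adjacent letters, or all words of `X*` are powers of
one letter. -/
theorem exists_adjacent_ne_or_forall_eq {A : Type*} [Nonempty A] (X : Set (List A)) :
    (∃ a b, a ≠ b ∧ ∃ p q, p ++ [a, b] ++ q ∈ Kstar X) ∨
      ∃ a, ∀ w ∈ Kstar X, ∀ x ∈ w, x = a := by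
  by_contra! hcon
  obtain ⟨h₁, h₂⟩ := hcon
  have hchain : ∀ w ∈ Kstar X, w.Pairwise Eq := fun w hw =>
    List.isChain_iff_pairwise.1 <| List.isChain_iff_forall_rel_of_append_cons_cons.2
      fun {a b p q} hwe => by
        by_contra hab
        exact h₁ a b hab p q (by simpa [← hwe] using hw)
  obtain ⟨w, hw, a, haw, -⟩ := h₂ (Classical.arbitrary A)
  obtain ⟨w', hw', b, hbw, hba⟩ := h₂ a
  exact hba ((List.pairwise_append.1 (hchain _ (append_mem_Kstar hw hw'))).2.2 a haw b hbw).symm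

theorem exists_block_code_aligned {A B : Type*} [Fintype A] [Fintype B]
    (hA : 2 ≤ Fintype.card A) (hB : Fintype.card B = 2) {k : ℕ} (hk : 2 ≤ k)
    (hAk : Fintype.card A + 1 ≤ 2 ^ k) (X : Set (List A)) :
    ∃ φ : A → List B, (∀ c, (φ c).length = k) ∧ Function.Injective φ ∧ ∃ z ∈ Kstar X,
      ∀ t ∈ Kstar X, ∀ r s, mlift φ t = r ++ mlift φ z ++ s → k ∣ r.length := by
  have : Nontrivial A := Fintype.one_lt_card_iff_nontrivial.1 hA
  have : Nontrivial B := Fintype.one_lt_card_iff_nontrivial.1 (by omega)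
  obtain ⟨o, i, hoi⟩ := exists_pair_ne B
  rcases exists_adjacent_ne_or_forall_eq X with ⟨a, b, hab, p, q, hz⟩ | ⟨a, ha⟩
  · obtain ⟨φ, hφ, hinj, hne, hφa, hφb⟩ := exists_block_code hB hk hAk hab hoi
    refine ⟨φ, hφ, hinj, _, hz, fun t _ r s h => ?_⟩
    have := dvd_length_of_mlift_eq hφ (by omega) hne hφa hφb
      (t := t) (r := r ++ mlift φ p) (s := mlift φ q ++ s)
      (by simpa [mlift_append, mlift_cons, mlift] using h)
    rw [List.length_append, length_mlift hφ] at this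
    exact (Nat.dvd_add_left (dvd_mul_right _ _)).1 this
  · obtain ⟨b, hba⟩ := exists_ne a
    obtain ⟨φ, hφ, hinj, -, hφa, -⟩ := exists_block_code hB hk hAk hba.symm hoi
    refine ⟨φ, hφ, hinj, ?_⟩
    by_cases hX : ∃ z ∈ Kstar X, z ≠ []
    · obtain ⟨z, hz, hz₀⟩ := hX
      refine ⟨z, hz, fun t ht r s h => ?_⟩
      obtain ⟨c, z, rfl⟩ := List.exists_cons_of_ne_nil hz₀
      obtain rfl : c = a := ha _ hz c (by simp)
      have hlt := Nat.mod_lt r.length (show 0 < k by omega)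
      have h₁ : (mlift φ t)[r.length]? = some i := by
        rw [h, mlift_cons, List.append_assoc, List.append_assoc,
          List.getElem?_append_right le_rfl, Nat.sub_self,
          List.getElem?_append_left (by rw [hφ]; omega), hφa 0 (by omega), if_pos rfl]
      rw [← Nat.div_add_mod r.length k, getElem?_mlift hφ t _ hlt] at h₁
      obtain ⟨x, hx, hxi⟩ := Option.bind_eq_some_iff.1 h₁
      rw [ha t ht x (List.mem_of_getElem? hx), hφa _ hlt, Option.some_inj] at hxi
      refine Nat.dvd_of_mod_eq_zero ?_
      by_contra hmod
      exact hoi (by simpa [hmod] using hxi)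
    · push Not at hX
      refine ⟨[], nil_mem_Kstar X, fun t ht r s h => ?_⟩
      rw [hX t ht] at h
      have hlen := congrArg List.length h
      simp only [mlift, List.map_nil, List.flatten_nil, List.append_nil, List.length_nil,
        List.length_append] at hlen
      rw [show r.length = 0 by omega]
      exact dvd_zero k

/-- Reduction to the binary case for synchronizing pairs of finite (not necessarily complete)
synchronizing sets. -/
theorem syncPair_reduction_to_binary {A B : Type*} [Fintype A] [Fintype B]
    (d n c : ℕ) (hA : Fintype.card A = d) (hd : 2 ≤ d) (hB : Fintype.card B = 2)
    (hn : 1 ≤ n) (hc : 0 < c)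
    (X : Set (List A)) (hXfin : X.Finite) (hXlen : ∀ w ∈ X, w.length ≤ n)
    (hXsync : IsSynchronizing X)
    (hC : ∀ Y : Set (List B), Y.Finite → (∀ w ∈ Y, w.length ≤ Nat.clog 2 (d + 1) * n) →
      IsSynchronizing Y →
      ∃ u v : List B, IsSyncPair Y u v ∧ (u ++ v).length ≤ c) :
    ∃ u v : List A, IsSyncPair X u v ∧
      ((u ++ v).length : ℤ) ≤ ⌈(c : ℚ) / (Nat.clog 2 (d + 1) : ℚ)⌉ := by
  set k := Nat.clog 2 (d + 1) with hk_def
  have hdk : d + 1 ≤ 2 ^ k := Nat.le_pow_clog (by norm_num) _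
  have hk : 2 ≤ k := by
    by_contra hlt
    have : 2 ^ k ≤ 2 ^ 1 := Nat.pow_le_pow_right (by norm_num) (by omega)
    omega
  have hk₀ : 0 < k := by omega
  obtain ⟨φ, hφ, hinj, z, hz, haligned⟩ :=
    exists_block_code_aligned (hA ▸ hd) hB hk (hA ▸ hdk) X
  obtain ⟨u, v, huv⟩ := hXsync
  obtain ⟨u', v', huv', hlen⟩ := hC (mlift φ '' X) (hXfin.image _)
    (by
      rintro _ ⟨x, hx, rfl⟩
      rw [length_mlift hφ]
      exact Nat.mul_le_mul_left k (hXlen x hx))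
    ⟨_, _, huv.mlift_image hφ hk₀ hinj hz haligned⟩
  obtain ⟨u, v, hsync, rfl, rfl⟩ := huv'.exists_of_mlift_image hφ hk₀ hinj
  refine ⟨u, v, hsync, ?_⟩
  rw [← mlift_append, length_mlift hφ] at hlen
  have hle : (((u ++ v).length : ℤ) : ℚ) ≤ (c : ℚ) / (k : ℚ) := by
    rw [le_div_iff₀ (by exact_mod_cast hk₀), mul_comm]
    exact_mod_cast hlen
  exact_mod_cast hle.trans (Int.le_ceil _)
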